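/- Let A be a finite nonempty type, r : A → ℝ, z : A → ℝ logits, π_z the softmax policy, H the entropy, J(z) = ∑_a π_z(a) · r(a), A_z(a) = r(a) - J(z), and μ = ∑_a π_z(a) · log π_z(a). For η, α ∈ ℝ, define the entropy-regularized update direction Δ_reg(a) = η · π_z(a) · A_z(a) - α·η · π_z(a) · (log π_z(a) - μ). Then the Fréchet derivative of H at z applied to Δ_reg equals -η · Cov_{π_z}(a ↦ log π_z(a), a ↦ π_z(a) · A_z(a)) + α·η · Cov_{π_z}(a ↦ log π_z(a), a ↦ π_z(a) · (log π_z(a) - μ)). -/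

import Mathlib

/-- Softmax policy induced by logits `z`. -/
noncomputable def softmax {A : Type*} [Fintype A] (z : A → ℝ) (a : A) : ℝ :=
  Real.exp (z a) / ∑ a', Real.exp (z a')

/-- Shannon entropy of the softmax policy. -/
noncomputable def entropy {A : Type*} [Fintype A] (z : A → ℝ) : ℝ :=
  -∑ a, softmax z a * Real.log (softmax z a)

/-- Expected reward of the softmax policy. -/
noncomputable def expReward {A : Type*} [Fintype A] (r : A → ℝ) (z : A → ℝ) : ℝ :=
  ∑ a, softmax z a * r a

/-- Advantage of action `a` under the softmax policy with logits `z`. -/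
noncomputable def advantage {A : Type*} [Fintype A] (r : A → ℝ) (z : A → ℝ) (a : A) : ℝ :=
  r a - expReward r z

/-- Covariance of `f` and `g` under the probability vector `p`. -/
noncomputable def cov {A : Type*} [Fintype A] (p f g : A → ℝ) : ℝ :=
  ∑ a, p a * (f a - ∑ a', p a' * f a') * (g a - ∑ a', p a' * g a')

theorem sum_exp_pos {A : Type*} [Fintype A] [Nonempty A] (z : A → ℝ) :
    0 < ∑ a, Real.exp (z a) :=
  Finset.sum_pos (fun _ _ => Real.exp_pos _) Finset.univ_nonempty

theorem softmax_pos {A : Type*} [Fintype A] [Nonempty A] (z : A → ℝ) (a : A) :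
    0 < softmax z a :=
  div_pos (Real.exp_pos _) (sum_exp_pos z)

theorem sum_softmax {A : Type*} [Fintype A] [Nonempty A] (z : A → ℝ) :
    ∑ a, softmax z a = 1 := by
  simp only [softmax, ← Finset.sum_div]
  exact div_self (sum_exp_pos z).ne'

theorem log_softmax {A : Type*} [Fintype A] [Nonempty A] (z : A → ℝ) (a : A) :
    Real.log (softmax z a) = z a - Real.log (∑ a', Real.exp (z a')) := by
  rw [softmax, Real.log_div (Real.exp_pos _).ne' (sum_exp_pos z).ne', Real.log_exp]

/-- The expectation under the softmax policy, as a continuous linear functional. -/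
noncomputable def softmaxExpectation {A : Type*} [Fintype A] (z : A → ℝ) :
    (A → ℝ) →L[ℝ] ℝ :=
  ∑ a, softmax z a • ContinuousLinearMap.proj (R := ℝ) (φ := fun _ : A => ℝ) a

theorem softmaxExpectation_apply {A : Type*} [Fintype A] (z v : A → ℝ) :
    softmaxExpectation z v = ∑ a, softmax z a * v a := by
  simp [softmaxExpectation]

theorem hasFDerivAt_log_softmax {A : Type*} [Fintype A] [Nonempty A] (z : A → ℝ) (a : A) :
    HasFDerivAt (fun x : A → ℝ => Real.log (softmax x a))
      (ContinuousLinearMap.proj a - softmaxExpectation z) z := by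
  simp only [log_softmax]
  have hsum : HasFDerivAt (fun x : A → ℝ => ∑ a', Real.exp (x a'))
      (∑ a', Real.exp (z a') •
        ContinuousLinearMap.proj (R := ℝ) (φ := fun _ : A => ℝ) a') z :=
    HasFDerivAt.fun_sum fun a' _ => (hasFDerivAt_apply a' z).exp
  refine ((hasFDerivAt_apply (𝕜 := ℝ) a z).fun_sub
    (hsum.log (sum_exp_pos z).ne')).congr_fderiv ?_
  simp only [softmaxExpectation, softmax, Finset.smul_sum, smul_smul, div_eq_inv_mul]

theorem hasFDerivAt_softmax {A : Type*} [Fintype A] [Nonempty A] (z : A → ℝ) (a : A) :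
    HasFDerivAt (fun x : A → ℝ => softmax x a)
      (softmax z a • (ContinuousLinearMap.proj a - softmaxExpectation z)) z := by
  simpa only [Real.exp_log (softmax_pos _ _)] using (hasFDerivAt_log_softmax z a).exp

/-- The directional derivative of the entropy is minus the covariance of the
log-policy with the direction. -/
theorem fderiv_entropy_apply {A : Type*} [Fintype A] [Nonempty A] (z v : A → ℝ) :
    fderiv ℝ entropy z v = -cov (softmax z) (fun a => Real.log (softmax z a)) v := by
  have h : HasFDerivAt entropy _ z :=
    (HasFDerivAt.fun_sum fun a (_ : a ∈ Finset.univ) =>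
      (hasFDerivAt_softmax z a).mul (hasFDerivAt_log_softmax z a)).neg
  have hcentered : ∑ a, softmax z a * (v a - ∑ a', softmax z a' * v a') = 0 := by
    simp only [mul_sub, Finset.sum_sub_distrib, ← Finset.sum_mul, sum_softmax, one_mul, sub_self]
  rw [h.fderiv]
  simp only [neg_apply, sum_apply, add_apply, smul_apply, sub_apply,
    ContinuousLinearMap.proj_apply, softmaxExpectation_apply, smul_eq_mul, cov]
  rw [neg_inj, Finset.sum_add_distrib, hcentered, zero_add, ← sub_eq_zero,
    ← Finset.sum_sub_distrib]
  set m := ∑ a, softmax z a * Real.log (softmax z a)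
  rw [← mul_zero m, ← hcentered, Finset.mul_sum]
  exact Finset.sum_congr rfl fun a _ => by ring

/-- Entropy dynamics under traditional entropy regularization: the Fréchet derivative
of the entropy at `z` applied to the regularized update direction
`Δ_reg(a) = η·π_z(a)·A_z(a) - α·η·π_z(a)·(log π_z(a) - μ)` equals
`-η·Cov(log π_z, π_z·A_z) + α·η·Cov(log π_z, π_z·(log π_z - μ))`. -/
theorem entropy_dynamics_regularized {A : Type*} [Fintype A] [Nonempty A]
    (r : A → ℝ) (z : A → ℝ) (η α : ℝ) :
    fderiv ℝ entropy z
        (fun a => η * (softmax z a * advantage r z a) -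
          α * η * (softmax z a *
            (Real.log (softmax z a) - ∑ a', softmax z a' * Real.log (softmax z a')))) =
      -(η * cov (softmax z) (fun a => Real.log (softmax z a))
          (fun a => softmax z a * advantage r z a)) +
        α * η * cov (softmax z) (fun a => Real.log (softmax z a))
          (fun a => softmax z a *
            (Real.log (softmax z a) - ∑ a', softmax z a' * Real.log (softmax z a'))) := by
  let u : A → ℝ := fun a => softmax z a * advantage r z a
  let w : A → ℝ := fun a => softmax z a *
    (Real.log (softmax z a) - ∑ a', softmax z a' * Real.log (softmax z a'))
  change fderiv ℝ entropy z (η • u - (α * η) • w) = _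
  rw [map_sub, map_smul, map_smul, fderiv_entropy_apply, fderiv_entropy_apply,
    smul_eq_mul, smul_eq_mul]
  ring
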